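/- arXiv:q-alg/9708014 — 6 statements merged into one kernel-verified Lean document; each statement's English description precedes it below -/
import Mathlib

section
/- P is an H-Galois extension of B if and only if the sequence of left P-modules 0 → P(Ω¹B)P → Ω¹P → P ⊗ H⁺ → 0 is exact, where the first map is the inclusion and the second is can̄; that is, if and only if can̄ : Ω¹P → P ⊗ H⁺ is surjective and Ker(can̄) = P(Ω¹B)P. -/
open TensorProduct

noncomputable section

variable (k : Type) [Field k] (P : Type) [Ring P] [Algebra k P]
variable (H : Type) [Ring H] [HopfAlgebra k H]

/-- The multiplication map `m : P ⊗[k] P → P`, as a map of left `P`-modules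
(left `P`-action on `P ⊗[k] P` on the first factor).  Its kernel is the universal
first order differential calculus `Ω¹P`. -/
def mulMap : (P ⊗[k] P) →ₗ[P] P :=
  TensorProduct.AlgebraTensorModule.lift
    { toFun := fun a => a • (LinearMap.id : P →ₗ[k] P)
      map_add' := fun a b => add_smul a b _
      map_smul' := fun p a => by simp [smul_eq_mul, mul_smul] }

@[simp] lemma mulMap_tmul (a b : P) : mulMap k P (a ⊗ₜ[k] b) = a * b := by
  simp [mulMap]

/-- `Ω¹P`, the universal first order differential calculus on `P`:
the kernel of the multiplication map `P ⊗ P → P`. -/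
def omega1 : Submodule P (P ⊗[k] P) := LinearMap.ker (mulMap k P)

/-- The map `(m ⊗ id) ∘ (id ⊗ Δ_R) : P ⊗ P → P ⊗ H` (on pure tensors,
`p ⊗ p' ↦ (p ⊗ 1) · Δ_R p'`), as a map of left `P`-modules.  The map `can̄` of the
paper is its restriction to `Ω¹P`. -/
def betaMap (Δ : P →ₐ[k] P ⊗[k] H) : (P ⊗[k] P) →ₗ[P] (P ⊗[k] H) :=
  TensorProduct.AlgebraTensorModule.lift
    { toFun := fun a => a • Δ.toLinearMap
      map_add' := fun a b => add_smul a b _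
      map_smul' := fun p a => by simp [smul_eq_mul, mul_smul] }

@[simp] lemma betaMap_tmul (Δ : P →ₐ[k] P ⊗[k] H) (a b : P) :
    betaMap k P H Δ (a ⊗ₜ[k] b) = a • (Δ b) := by
  simp [betaMap]

set_option synthInstance.maxHeartbeats 1000000 in
/-- `betaMap` is indeed `(m ⊗ id) ∘ (assoc)⁻¹ ∘ (id ⊗ Δ_R)`. -/
lemma betaMap_eq (Δ : P →ₐ[k] P ⊗[k] H) (x : P ⊗[k] P) :
    betaMap k P H Δ x =
      ((TensorProduct.map (LinearMap.mul' k P) LinearMap.id) ∘ₗ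
        (TensorProduct.assoc k P P H).symm.toLinearMap ∘ₗ
          (TensorProduct.map LinearMap.id Δ.toLinearMap)) x := by
  simp only [LinearMap.comp_apply, LinearEquiv.coe_coe]
  induction x using TensorProduct.induction_on with
  | zero => simp
  | tmul a b =>
      simp only [betaMap_tmul, TensorProduct.map_tmul, LinearMap.id_coe, id_eq,
        AlgHom.toLinearMap_apply]
      generalize Δ b = t
      induction t using TensorProduct.induction_on with
      | zero => simp
      | tmul x h => simp [TensorProduct.smul_tmul', smul_eq_mul]
      | add t₁ t₂ h₁ h₂ => simp [tmul_add, smul_add, h₁, h₂]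
  | add x y hx hy => simp [hx, hy]

/-- Coassociativity of the coaction `Δ_R` (comodule axiom). -/
def IsCoassoc (Δ : P →ₐ[k] P ⊗[k] H) : Prop :=
  ∀ p : P,
    (TensorProduct.assoc k P H H)
        ((TensorProduct.map Δ.toLinearMap LinearMap.id) (Δ p)) =
      (TensorProduct.map LinearMap.id (Coalgebra.comul (R := k) (A := H))) (Δ p)

/-- Counitality of the coaction `Δ_R` (comodule axiom):
`(id ⊗ ε) ∘ Δ_R = id` (under `P ⊗ k ≅ P`). -/
def IsCounital (Δ : P →ₐ[k] P ⊗[k] H) : Prop :=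
  ∀ p : P,
    (TensorProduct.map (LinearMap.id : P →ₗ[k] P) (Coalgebra.counit (R := k) (A := H)))
        (Δ p) = p ⊗ₜ[k] (1 : k)

/-- The set of coinvariants `B := P^{co H} = {p | Δ_R p = p ⊗ 1}`. -/
def coinv (Δ : P →ₐ[k] P ⊗[k] H) : Set P := {b | Δ b = b ⊗ₜ[k] (1 : H)}

/-- `P(Ω¹B)P ⊆ Ω¹P`: the `P`-subbimodule of `Ω¹P` generated by `Ω¹B`, i.e. the span of
the elements `p(1 ⊗ b - b ⊗ 1)p' = p ⊗ (b p') - (p b) ⊗ p'` with `b ∈ B = P^{co H}`,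
`p, p' ∈ P`.  This is also the subspace of relations defining `P ⊗_B P`. -/
def POmega1BP (Δ : P →ₐ[k] P ⊗[k] H) : Submodule P (P ⊗[k] P) :=
  Submodule.span P
    {x | ∃ b p', b ∈ coinv k P H Δ ∧ x = (1 : P) ⊗ₜ[k] (b * p') - b ⊗ₜ[k] p'}

/-- `H⁺ := Ker ε`, the augmentation ideal of `H`. -/
def hPlus : Submodule k H := LinearMap.ker (Coalgebra.counit (R := k) (A := H))

/-- For a subspace `V ⊆ H`, the subspace `P ⊗ V` of `P ⊗ H`. -/
def ptensor (V : Submodule k H) : Submodule P (P ⊗[k] H) :=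
  Submodule.span P {x | ∃ v ∈ V, x = (1 : P) ⊗ₜ[k] v}

/-- `P(Ω¹B)P` is contained in the kernel of `(m ⊗ id) ∘ (id ⊗ Δ_R)`. -/
lemma POmega1BP_le_ker (Δ : P →ₐ[k] P ⊗[k] H) :
    POmega1BP k P H Δ ≤ LinearMap.ker (betaMap k P H Δ) := by
  rw [POmega1BP, Submodule.span_le]
  rintro x ⟨b, p', hb, rfl⟩
  have hone : ∀ t : P ⊗[k] H, (b ⊗ₜ[k] (1 : H)) * t = b • t := by
    intro t
    induction t using TensorProduct.induction_on with
    | zero => simp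
    | tmul x h => simp [Algebra.TensorProduct.tmul_mul_tmul, TensorProduct.smul_tmul', smul_eq_mul]
    | add t₁ t₂ h₁ h₂ => simp [mul_add, smul_add, h₁, h₂]
  have hmem : Δ b = b ⊗ₜ[k] (1 : H) := hb
  simp only [SetLike.mem_coe, LinearMap.mem_ker, map_sub, betaMap_tmul, one_smul,
    map_mul, hmem, hone, sub_self]

/-- The canonical map `can : P ⊗_B P → P ⊗ H`, where `P ⊗_B P` is realized as the
quotient of `P ⊗[k] P` by the relation subspace. -/
def canMap (Δ : P →ₐ[k] P ⊗[k] H) :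
    ((P ⊗[k] P) ⧸ POmega1BP k P H Δ) →ₗ[P] (P ⊗[k] H) :=
  Submodule.liftQ _ (betaMap k P H Δ) (POmega1BP_le_ker k P H Δ)

/-- `P` is an `H`-Galois extension of `B := P^{co H}` iff the canonical map
`can : P ⊗_B P → P ⊗ H` is bijective. -/
def IsGaloisExtension (Δ : P →ₐ[k] P ⊗[k] H) : Prop :=
  Function.Bijective (canMap k P H Δ)

/-- The induced map `χ : Ω¹(P) = Ω¹P/N_P → P ⊗ (H⁺/V)`, where the codomain is realized
inside `(P ⊗ H)/(P ⊗ V)`; `χ` satisfies `χ ∘ π_P = (id ⊗ π_H) ∘ can̄`. -/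
def chiMap (Δ : P →ₐ[k] P ⊗[k] H) (N : Submodule P (P ⊗[k] P)) (V : Submodule k H)
    (hcompat : Submodule.map (betaMap k P H Δ) N ≤ ptensor k P H V) :
    ((↥(omega1 k P)) ⧸ N.comap (omega1 k P).subtype) →ₗ[P]
      ((P ⊗[k] H) ⧸ ptensor k P H V) :=
  Submodule.liftQ _
    ((ptensor k P H V).mkQ ∘ₗ (betaMap k P H Δ) ∘ₗ (omega1 k P).subtype)
    (by
      intro x hx
      have hx' : (x : P ⊗[k] P) ∈ N := hx
      simp only [LinearMap.mem_ker, LinearMap.comp_apply, Submodule.subtype_apply,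
        Submodule.mkQ_apply, Submodule.Quotient.mk_eq_zero]
      exact hcompat (Submodule.mem_map.mpr ⟨(x : P ⊗[k] P), hx', rfl⟩))


/-- The left `P`-linear map `id ⊗ ε : P ⊗ H → P`. -/
def counitMap : (P ⊗[k] H) →ₗ[P] P :=
  TensorProduct.AlgebraTensorModule.lift
    { toFun := fun a => (LinearMap.toSpanSingleton k P a) ∘ₗ (Coalgebra.counit (R := k) (A := H))
      map_add' := fun a b => by ext h; simp
      map_smul' := fun p a => by ext h; simp }

lemma counitMap_tmul (a : P) (h : H) :
    counitMap k P H (a ⊗ₜ[k] h) = Coalgebra.counit (R := k) h • a := by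
  simp [counitMap]

lemma counitMap_eq (t : P ⊗[k] H) :
    counitMap k P H t = TensorProduct.rid k P
      ((TensorProduct.map (LinearMap.id : P →ₗ[k] P)
        (Coalgebra.counit (R := k) (A := H))) t) := by
  induction t using TensorProduct.induction_on with
  | zero => simp
  | tmul x h => simp [counitMap_tmul]
  | add t₁ t₂ h₁ h₂ => simp only [map_add, h₁, h₂]

lemma counitMap_betaMap (Δ : P →ₐ[k] P ⊗[k] H) (hcu : IsCounital k P H Δ) (x : P ⊗[k] P) :
    counitMap k P H (betaMap k P H Δ x) = mulMap k P x := by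
  induction x using TensorProduct.induction_on with
  | zero => simp
  | tmul a b => rw [betaMap_tmul, map_smul, counitMap_eq, hcu b]; simp
  | add x y hx hy => simp only [map_add, hx, hy]

lemma sub_mem_ptensor (x : P ⊗[k] H) :
    x - counitMap k P H x • ((1 : P) ⊗ₜ[k] (1 : H)) ∈ ptensor k P H (hPlus k H) := by
  induction x using TensorProduct.induction_on with
  | zero => simp
  | tmul a h =>
      have e : a ⊗ₜ[k] h - counitMap k P H (a ⊗ₜ[k] h) • ((1 : P) ⊗ₜ[k] (1 : H)) =
          a • ((1 : P) ⊗ₜ[k] (h - Coalgebra.counit (R := k) h • (1 : H))) := by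
        rw [counitMap_tmul, tmul_sub, smul_sub, TensorProduct.smul_tmul', TensorProduct.smul_tmul',
          TensorProduct.smul_tmul']
        simp only [smul_eq_mul, mul_one]
        rw [TensorProduct.smul_tmul]
      rw [e]
      refine Submodule.smul_mem _ _ (Submodule.subset_span ⟨_, ?_, rfl⟩)
      simp [hPlus, LinearMap.mem_ker]
  | add x y hx hy =>
      rw [map_add, add_smul, add_sub_add_comm]
      exact Submodule.add_mem _ hx hy

lemma ptensor_hPlus_eq : ptensor k P H (hPlus k H) = LinearMap.ker (counitMap k P H) := by
  apply le_antisymm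
  · rw [ptensor, Submodule.span_le]
    rintro x ⟨v, hv, rfl⟩
    have hv' : Coalgebra.counit (R := k) v = 0 := hv
    simp [counitMap_tmul, hv']
  · intro x hx
    have h := sub_mem_ptensor k P H x
    rw [LinearMap.mem_ker.mp hx, zero_smul, sub_zero] at h
    exact h

/-- `P` is an `H`-Galois extension of `B` if and only if the sequence of left
`P`-modules `0 → P(Ω¹B)P → Ω¹P → P ⊗ H⁺ → 0` is exact (first map the inclusion, second
the map `can̄`), i.e. iff `can̄ : Ω¹P → P ⊗ H⁺` is surjective and `Ker can̄ = P(Ω¹B)P`. -/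
theorem galois_iff_universal_sequence_exact
    (Δ : P →ₐ[k] P ⊗[k] H) (hco : IsCoassoc k P H Δ) (hcu : IsCounital k P H Δ) :
    IsGaloisExtension k P H Δ ↔
      (Submodule.map (betaMap k P H Δ) (omega1 k P) = ptensor k P H (hPlus k H) ∧
        omega1 k P ⊓ LinearMap.ker (betaMap k P H Δ) = POmega1BP k P H Δ) := by
  have hm := counitMap_betaMap k P H Δ hcu
  have hker : omega1 k P ⊓ LinearMap.ker (betaMap k P H Δ) = LinearMap.ker (betaMap k P H Δ) := by
    refine inf_eq_right.mpr fun x hx => ?_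
    rw [omega1, LinearMap.mem_ker, ← hm, LinearMap.mem_ker.mp hx, map_zero]
  have hinj : Function.Injective (canMap k P H Δ) ↔
      LinearMap.ker (betaMap k P H Δ) = POmega1BP k P H Δ := by
    rw [← LinearMap.ker_eq_bot, canMap, Submodule.ker_liftQ, eq_bot_iff, Submodule.map_le_iff_le_comap,
      Submodule.comap_bot, Submodule.ker_mkQ]
    exact ⟨fun h => le_antisymm h (POmega1BP_le_ker k P H Δ), fun h => h.le⟩
  have hsurj : Function.Surjective (canMap k P H Δ) ↔
      LinearMap.range (betaMap k P H Δ) = ⊤ := by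
    rw [← LinearMap.range_eq_top, canMap, Submodule.range_liftQ]
  have hmap : Submodule.map (betaMap k P H Δ) (omega1 k P) = ptensor k P H (hPlus k H) ↔
      LinearMap.range (betaMap k P H Δ) = ⊤ := by
    rw [ptensor_hPlus_eq]
    constructor
    · intro h
      rw [eq_top_iff]
      intro x _
      have h1 := sub_mem_ptensor k P H x
      rw [ptensor_hPlus_eq, ← h] at h1
      obtain ⟨y, -, hy⟩ := h1
      refine ⟨y + counitMap k P H x • ((1 : P) ⊗ₜ[k] (1 : P)), ?_⟩
      rw [map_add, hy, map_smul, betaMap_tmul, map_one, one_smul,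
        Algebra.TensorProduct.one_def, sub_add_cancel]
    · intro h
      apply le_antisymm
      · rintro _ ⟨y, hy, rfl⟩
        rw [LinearMap.mem_ker, hm]
        exact hy
      · intro x hx
        obtain ⟨y, rfl⟩ := LinearMap.range_eq_top.mp h x
        refine ⟨y, ?_, rfl⟩
        rw [LinearMap.mem_ker, hm] at hx
        exact hx
  rw [hker, hmap, ← hinj, ← hsurj]
  exact and_comm

end
end

section
/- Suppose N_P is a P-subbimodule of Ω¹P and V is a vector subspace of H⁺ satisfying the compatibility condition can̄(N_P) = P ⊗ V. Then the following are equivalent: (1) P is an H-Galois extension of B; (2) the sequence of left P-modules 0 → PΩ¹(B)P → Ω¹(P) → P ⊗ (H⁺/V) → 0 (with inclusion followed by χ) is exact, and N_P ∩ Ker(can̄) ⊆ P(Ω¹B)P. -/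
open TensorProduct

noncomputable section

variable (k : Type) [Field k] (P : Type) [Ring P] [Algebra k P]
variable (H : Type) [Ring H] [HopfAlgebra k H]

/-- The map `id ⊗ ε : P ⊗ H → P`, left `P`-linear. -/
def epsMap : (P ⊗[k] H) →ₗ[P] P :=
  TensorProduct.AlgebraTensorModule.lift
    { toFun := fun a => (LinearMap.toSpanSingleton k P a) ∘ₗ (Coalgebra.counit (R := k) (A := H))
      map_add' := fun a b => by ext h; simp
      map_smul' := fun p a => by ext h; simp }

lemma epsMap_tmul (a : P) (h : H) :
    epsMap k P H (a ⊗ₜ[k] h) = Coalgebra.counit (R := k) h • a := by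
  simp [epsMap]

lemma epsMap_eq (y : P ⊗[k] H) :
    epsMap k P H y = TensorProduct.rid k P
      ((TensorProduct.map (LinearMap.id : P →ₗ[k] P)
        (Coalgebra.counit (R := k) (A := H))) y) := by
  induction y using TensorProduct.induction_on with
  | zero => simp
  | tmul a h => simp [epsMap_tmul]
  | add x y hx hy => simp only [map_add, hx, hy]

lemma epsMap_beta (Δ : P →ₐ[k] P ⊗[k] H) (hcu : IsCounital k P H Δ) (x : P ⊗[k] P) :
    epsMap k P H (betaMap k P H Δ x) = mulMap k P x := by
  induction x using TensorProduct.induction_on with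
  | zero => simp
  | tmul a b =>
    rw [betaMap_tmul, map_smul, epsMap_eq, hcu b]
    simp
  | add x y hx hy => simp only [map_add, hx, hy]

lemma sub_eps_mem (y : P ⊗[k] H) :
    y - (epsMap k P H y) ⊗ₜ[k] (1 : H) ∈ ptensor k P H (hPlus k H) := by
  induction y using TensorProduct.induction_on with
  | zero => simp
  | tmul a h =>
    have h1 : a ⊗ₜ[k] h - (epsMap k P H (a ⊗ₜ[k] h)) ⊗ₜ[k] (1 : H) =
        a • ((1 : P) ⊗ₜ[k] (h - Coalgebra.counit (R := k) h • (1 : H))) := by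
      rw [epsMap_tmul, TensorProduct.smul_tmul, TensorProduct.smul_tmul', tmul_sub]
      simp
    rw [h1]
    refine Submodule.smul_mem _ _ (Submodule.subset_span ⟨_, ?_, rfl⟩)
    simp [hPlus, LinearMap.mem_ker]
  | add x y hx hy =>
    rw [map_add, TensorProduct.add_tmul, add_sub_add_comm]
    exact Submodule.add_mem _ hx hy

lemma ptensor_hPlus_iff (y : P ⊗[k] H) :
    y ∈ ptensor k P H (hPlus k H) ↔ epsMap k P H y = 0 := by
  constructor
  · intro hy
    have hle : ptensor k P H (hPlus k H) ≤ LinearMap.ker (epsMap k P H) := by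
      rw [ptensor, Submodule.span_le]
      rintro x ⟨v, hv, rfl⟩
      have hv' : Coalgebra.counit (R := k) v = 0 := hv
      simp [epsMap_tmul, hv']
    exact hle hy
  · intro hy
    simpa [hy] using sub_eps_mem k P H y

/-- with `N_P` a `P`-subbimodule of `Ω¹P` and `V ⊆ H⁺` satisfying
`can̄(N_P) = P ⊗ V`, the following are equivalent: (1) `P` is an `H`-Galois extension of
`B`; (2) the sequence `0 → PΩ¹(B)P → Ω¹(P) → P ⊗ (H⁺/V) → 0` of left `P`-modules is
exact (`Ker χ` is the image of `P(Ω¹B)P` in `Ω¹(P)` and `χ` is surjective onto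
`P ⊗ (H⁺/V)`), and `N_P ∩ Ker can̄ ⊆ P(Ω¹B)P`. -/
theorem galois_iff_quotient_sequence_exact
    (Δ : P →ₐ[k] P ⊗[k] H) (hco : IsCoassoc k P H Δ) (hcu : IsCounital k P H Δ)
    (N : Submodule P (P ⊗[k] P)) (hN : N ≤ omega1 k P)
    (hNr : ∀ (p : P), ∀ x ∈ N,
      (TensorProduct.map LinearMap.id (LinearMap.mulRight k p)) x ∈ N)
    (V : Submodule k H) (hV : V ≤ hPlus k H)
    (hcompat : Submodule.map (betaMap k P H Δ) N = ptensor k P H V) :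
    IsGaloisExtension k P H Δ ↔
      (LinearMap.ker (chiMap k P H Δ N V hcompat.le) =
          Submodule.map (N.comap (omega1 k P).subtype).mkQ
            ((POmega1BP k P H Δ).comap (omega1 k P).subtype) ∧
        LinearMap.range (chiMap k P H Δ N V hcompat.le) =
          Submodule.map (ptensor k P H V).mkQ (ptensor k P H (hPlus k H)) ∧
        N ⊓ LinearMap.ker (betaMap k P H Δ) ≤ POmega1BP k P H Δ) := by
  have hβΩ : ∀ x, x ∈ omega1 k P ↔
      betaMap k P H Δ x ∈ ptensor k P H (hPlus k H) := fun x => by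
    rw [ptensor_hPlus_iff, epsMap_beta k P H Δ hcu]; rfl
  have hQ : ∀ x ∈ POmega1BP k P H Δ, betaMap k P H Δ x = 0 :=
    fun x hx => POmega1BP_le_ker k P H Δ hx
  have hkΩ : ∀ x, betaMap k P H Δ x = 0 → x ∈ omega1 k P := fun x hx => by
    rw [hβΩ, hx]; exact Submodule.zero_mem _
  have hχ : ∀ x : omega1 k P, chiMap k P H Δ N V hcompat.le
      ((N.comap (omega1 k P).subtype).mkQ x) =
        (ptensor k P H V).mkQ (betaMap k P H Δ x) := fun x => rfl
  have hVN : ∀ y ∈ ptensor k P H V, ∃ n ∈ N, betaMap k P H Δ n = y := fun y hy => by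
    rw [← hcompat] at hy; exact Submodule.mem_map.mp hy
  constructor
  · rintro ⟨hinj, hsurj⟩
    have hker : ∀ x, betaMap k P H Δ x = 0 → x ∈ POmega1BP k P H Δ := fun x hx => by
      rw [← Submodule.Quotient.mk_eq_zero]
      apply hinj
      rw [map_zero]
      exact hx
    have hs : ∀ y, ∃ x, betaMap k P H Δ x = y := fun y => by
      obtain ⟨q, hq⟩ := hsurj y
      obtain ⟨x, rfl⟩ := Submodule.mkQ_surjective _ q
      exact ⟨x, hq⟩
    refine ⟨?_, ?_, fun x hx => hker x hx.2⟩
    · ext q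
      obtain ⟨x, rfl⟩ := Submodule.mkQ_surjective _ q
      rw [LinearMap.mem_ker, hχ, Submodule.mkQ_apply, Submodule.Quotient.mk_eq_zero]
      constructor
      · intro hx
        obtain ⟨n, hn, hnx⟩ := hVN _ hx
        refine Submodule.mem_map.mpr ⟨x - ⟨n, hN hn⟩, ?_, ?_⟩
        · exact hker _ (by simp [hnx])
        · rw [map_sub, sub_eq_self, Submodule.mkQ_apply, Submodule.Quotient.mk_eq_zero]
          exact hn
      · intro hx
        obtain ⟨z, hz, hzx⟩ := Submodule.mem_map.mp hx
        have hz' : betaMap k P H Δ z = 0 := hQ _ hz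
        have h1 := hχ z
        rw [hzx, hχ, hz', map_zero, Submodule.mkQ_apply,
          Submodule.Quotient.mk_eq_zero] at h1
        exact h1
    · ext y
      constructor
      · rintro ⟨q, rfl⟩
        obtain ⟨x, rfl⟩ := Submodule.mkQ_surjective _ q
        rw [hχ]
        exact Submodule.mem_map_of_mem ((hβΩ x).1 x.2)
      · intro hy
        obtain ⟨z, hz, rfl⟩ := Submodule.mem_map.mp hy
        obtain ⟨x, rfl⟩ := hs z
        exact ⟨_, hχ ⟨x, (hβΩ x).2 hz⟩⟩
  · rintro ⟨hk, hr, hi⟩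
    have hker : ∀ x, betaMap k P H Δ x = 0 → x ∈ POmega1BP k P H Δ := fun x hx => by
      have h1 : (N.comap (omega1 k P).subtype).mkQ ⟨x, hkΩ x hx⟩ ∈
          LinearMap.ker (chiMap k P H Δ N V hcompat.le) := by
        rw [LinearMap.mem_ker, hχ, hx, map_zero]
      rw [hk] at h1
      obtain ⟨z, hz, hzx⟩ := Submodule.mem_map.mp h1
      have hz1 : (z : P ⊗[k] P) ∈ POmega1BP k P H Δ := hz
      have h2 : x - z ∈ N := by
        have := (Submodule.Quotient.eq _).1 hzx.symm
        exact this
      have h3 : x - z ∈ POmega1BP k P H Δ :=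
        hi ⟨h2, by rw [SetLike.mem_coe, LinearMap.mem_ker, map_sub, hx, hQ _ hz1, sub_zero]⟩
      simpa using Submodule.add_mem _ h3 hz1
    constructor
    · rw [← LinearMap.ker_eq_bot, eq_bot_iff]
      intro q hq
      obtain ⟨x, rfl⟩ := Submodule.mkQ_surjective _ q
      have hx : betaMap k P H Δ x = 0 := hq
      rw [Submodule.mem_bot, Submodule.mkQ_apply, Submodule.Quotient.mk_eq_zero]
      exact hker x hx
    · intro y
      have h1 := Submodule.mem_map_of_mem (f := (ptensor k P H V).mkQ) (sub_eps_mem k P H y)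
      rw [← hr] at h1
      obtain ⟨q, hq⟩ := h1
      obtain ⟨x, rfl⟩ := Submodule.mkQ_surjective _ q
      rw [hχ] at hq
      obtain ⟨n, hn, hny⟩ := hVN _ ((Submodule.Quotient.eq _).1 hq)
      refine ⟨(POmega1BP k P H Δ).mkQ (x - n + (epsMap k P H y) ⊗ₜ[k] (1 : P)), ?_⟩
      change betaMap k P H Δ _ = y
      rw [map_add, map_sub, hny, betaMap_tmul, map_one, Algebra.TensorProduct.one_def,
        TensorProduct.smul_tmul', smul_eq_mul, mul_one]
      abel

end
end

section
/- Suppose N_P is a P-subbimodule of Ω¹P and V is a vector subspace of H⁺ satisfying can̄(N_P) = P ⊗ V. If the sequence of left P-modules 0 → PΩ¹(B)P → Ω¹(P) → P ⊗ (H⁺/V) → 0 (with inclusion followed by χ) is exact and N_P ∩ Ker(can̄) ⊆ P(Ω¹B)P, then P is an H-Galois extension of B. -/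
open TensorProduct

noncomputable section

variable (k : Type) [Field k] (P : Type) [Ring P] [Algebra k P]
variable (H : Type) [Ring H] [HopfAlgebra k H]

/-- with `N_P` a `P`-subbimodule of `Ω¹P` and `V ⊆ H⁺` satisfying
`can̄(N_P) = P ⊗ V`: if the sequence `0 → PΩ¹(B)P → Ω¹(P) → P ⊗ (H⁺/V) → 0` of left
`P`-modules is exact and `N_P ∩ Ker can̄ ⊆ P(Ω¹B)P`, then `P` is an `H`-Galois
extension of `B`. -/
theorem galois_of_quotient_sequence_exact
    (Δ : P →ₐ[k] P ⊗[k] H) (hco : IsCoassoc k P H Δ) (hcu : IsCounital k P H Δ)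
    (N : Submodule P (P ⊗[k] P)) (hN : N ≤ omega1 k P)
    (hNr : ∀ (p : P), ∀ x ∈ N,
      (TensorProduct.map LinearMap.id (LinearMap.mulRight k p)) x ∈ N)
    (V : Submodule k H) (hV : V ≤ hPlus k H)
    (hcompat : Submodule.map (betaMap k P H Δ) N = ptensor k P H V)
    (hker : LinearMap.ker (chiMap k P H Δ N V hcompat.le) =
          Submodule.map (N.comap (omega1 k P).subtype).mkQ
            ((POmega1BP k P H Δ).comap (omega1 k P).subtype))
    (hsurj : LinearMap.range (chiMap k P H Δ N V hcompat.le) =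
          Submodule.map (ptensor k P H V).mkQ (ptensor k P H (hPlus k H)))
    (hint : N ⊓ LinearMap.ker (betaMap k P H Δ) ≤ POmega1BP k P H Δ) :
    IsGaloisExtension k P H Δ := by
  have hmul : ∀ x : P ⊗[k] P,
      (TensorProduct.map (LinearMap.id : P →ₗ[k] P) (Coalgebra.counit (R := k) (A := H)))
        (betaMap k P H Δ x) = (mulMap k P x) ⊗ₜ[k] (1 : k) := by
    have hs : ∀ (a : P) (t : P ⊗[k] H),
        (TensorProduct.map (LinearMap.id : P →ₗ[k] P) (Coalgebra.counit (R := k) (A := H)))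
          (a • t) = a • (TensorProduct.map (LinearMap.id : P →ₗ[k] P)
            (Coalgebra.counit (R := k) (A := H))) t := by
      intro a t
      induction t using TensorProduct.induction_on with
      | zero => simp
      | tmul x h => simp [TensorProduct.smul_tmul']
      | add t₁ t₂ h₁ h₂ => simp only [smul_add, map_add, h₁, h₂]
    intro x
    induction x using TensorProduct.induction_on with
    | zero => simp
    | tmul a b =>
      rw [betaMap_tmul, hs, hcu b, mulMap_tmul, TensorProduct.smul_tmul', smul_eq_mul]
    | add x y hx hy => rw [map_add, map_add, hx, hy, map_add, TensorProduct.add_tmul]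
  have hom : ∀ x : P ⊗[k] P, betaMap k P H Δ x = 0 → x ∈ omega1 k P := by
    intro x hx
    have h := hmul x
    rw [hx, map_zero] at h
    have h2 := congrArg (TensorProduct.rid k P) h
    rw [map_zero, TensorProduct.rid_tmul, one_smul] at h2
    exact LinearMap.mem_ker.mpr h2.symm
  have hkerle : ∀ x : P ⊗[k] P, betaMap k P H Δ x = 0 → x ∈ POmega1BP k P H Δ := by
    intro x hx
    have hk : (N.comap (omega1 k P).subtype).mkQ ⟨x, hom x hx⟩ ∈
        LinearMap.ker (chiMap k P H Δ N V hcompat.le) := by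
      rw [LinearMap.mem_ker, chiMap, Submodule.mkQ_apply, Submodule.liftQ_apply]
      simp [hx]
    rw [hker] at hk
    obtain ⟨y, hy, hxy⟩ := hk
    have hy' : (y : P ⊗[k] P) ∈ POmega1BP k P H Δ := hy
    rw [Submodule.mkQ_apply, Submodule.mkQ_apply, Submodule.Quotient.eq] at hxy
    have hxy' : (y : P ⊗[k] P) - x ∈ N := hxy
    have hb : betaMap k P H Δ y = 0 := POmega1BP_le_ker k P H Δ hy'
    have h3 : (y : P ⊗[k] P) - x ∈ POmega1BP k P H Δ :=
      hint ⟨hxy', by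
        change betaMap k P H Δ ((y : P ⊗[k] P) - x) = 0
        rw [map_sub, hb, hx, sub_zero]⟩
    have h4 := Submodule.sub_mem _ hy' h3
    rwa [sub_sub_cancel] at h4
  have hplus : ptensor k P H (hPlus k H) ≤ LinearMap.range (betaMap k P H Δ) := by
    intro z hz
    have hz' : (ptensor k P H V).mkQ z ∈ LinearMap.range (chiMap k P H Δ N V hcompat.le) := by
      rw [hsurj]
      exact Submodule.mem_map_of_mem hz
    obtain ⟨w, hw⟩ := hz'
    obtain ⟨w, rfl⟩ := Submodule.mkQ_surjective _ w
    rw [chiMap, Submodule.mkQ_apply, Submodule.liftQ_apply] at hw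
    have hw' : (ptensor k P H V).mkQ (betaMap k P H Δ (w : P ⊗[k] P)) =
      (ptensor k P H V).mkQ z := hw
    rw [Submodule.mkQ_apply, Submodule.mkQ_apply, Submodule.Quotient.eq, ← hcompat] at hw'
    obtain ⟨n, -, hn⟩ := hw'
    exact ⟨(w : P ⊗[k] P) - n, by rw [map_sub, hn, sub_sub_cancel]⟩
  have hone : ∀ h : H, (1 : P) ⊗ₜ[k] h ∈ LinearMap.range (betaMap k P H Δ) := by
    intro h
    have e : (1 : P) ⊗ₜ[k] h = (1 : P) ⊗ₜ[k] (h - algebraMap k H (Coalgebra.counit (R := k) h)) +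
        (algebraMap k P (Coalgebra.counit (R := k) h)) • ((1 : P) ⊗ₜ[k] (1 : H)) := by
      rw [TensorProduct.smul_tmul', smul_eq_mul, mul_one, Algebra.algebraMap_eq_smul_one,
        Algebra.algebraMap_eq_smul_one, TensorProduct.smul_tmul, ← TensorProduct.tmul_add,
        sub_add_cancel]
    rw [e]
    refine Submodule.add_mem _ (hplus (Submodule.subset_span ⟨_, ?_, rfl⟩))
      (Submodule.smul_mem _ _ ⟨1 ⊗ₜ 1, ?_⟩)
    · change Coalgebra.counit (R := k) _ = 0
      rw [map_sub, Algebra.algebraMap_eq_smul_one, map_smul, Bialgebra.counit_one, smul_eq_mul,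
        mul_one, sub_self]
    · rw [betaMap_tmul, one_smul, map_one, Algebra.TensorProduct.one_def]
  have hsur : ∀ z : P ⊗[k] H, z ∈ LinearMap.range (betaMap k P H Δ) := by
    intro z
    induction z using TensorProduct.induction_on with
    | zero => exact Submodule.zero_mem _
    | tmul p h =>
      have := Submodule.smul_mem _ p (hone h)
      rwa [TensorProduct.smul_tmul', smul_eq_mul, mul_one] at this
    | add x y hx hy => exact Submodule.add_mem _ hx hy
  constructor
  · rw [← LinearMap.ker_eq_bot, LinearMap.ker_eq_bot']
    intro x hx
    obtain ⟨x, rfl⟩ := Submodule.mkQ_surjective _ x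
    rw [canMap, Submodule.mkQ_apply, Submodule.liftQ_apply] at hx
    rw [Submodule.mkQ_apply, Submodule.Quotient.mk_eq_zero]
    exact hkerle x hx
  · intro z
    obtain ⟨x, hx⟩ := hsur z
    refine ⟨(POmega1BP k P H Δ).mkQ x, ?_⟩
    rw [canMap, Submodule.mkQ_apply, Submodule.liftQ_apply, hx]

end
end

section
/- Suppose the canonical map can : P ⊗_B P → P ⊗ H is surjective, N_P is a P-subbimodule of Ω¹P, and V is a vector subspace of H⁺ with can̄(N_P) ⊆ P ⊗ V. If the sequence of left P-modules 0 → PΩ¹(B)P → Ω¹(P) → P ⊗ (H⁺/V) → 0 (with inclusion followed by χ) is exact, then can̄(N_P) = P ⊗ V. -/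
open TensorProduct

noncomputable section

variable (k : Type) [Field k] (P : Type) [Ring P] [Algebra k P]
variable (H : Type) [Ring H] [HopfAlgebra k H]

/-- suppose `can : P ⊗_B P → P ⊗ H` is surjective, `N_P` is a
`P`-subbimodule of `Ω¹P`, and `V ⊆ H⁺` satisfies `can̄(N_P) ⊆ P ⊗ V`.  If the sequence
`0 → PΩ¹(B)P → Ω¹(P) → P ⊗ (H⁺/V) → 0` of left `P`-modules is exact, then
`can̄(N_P) = P ⊗ V`. -/
theorem compat_eq_of_quotient_sequence_exact
    (Δ : P →ₐ[k] P ⊗[k] H) (hco : IsCoassoc k P H Δ) (hcu : IsCounital k P H Δ)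
    (hcan : Function.Surjective (canMap k P H Δ))
    (N : Submodule P (P ⊗[k] P)) (hN : N ≤ omega1 k P)
    (hNr : ∀ (p : P), ∀ x ∈ N,
      (TensorProduct.map LinearMap.id (LinearMap.mulRight k p)) x ∈ N)
    (V : Submodule k H) (hV : V ≤ hPlus k H)
    (hcompat : Submodule.map (betaMap k P H Δ) N ≤ ptensor k P H V)
    (hker : LinearMap.ker (chiMap k P H Δ N V hcompat) =
          Submodule.map (N.comap (omega1 k P).subtype).mkQ
            ((POmega1BP k P H Δ).comap (omega1 k P).subtype))
    (hsurj : LinearMap.range (chiMap k P H Δ N V hcompat) =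
          Submodule.map (ptensor k P H V).mkQ (ptensor k P H (hPlus k H))) :
    Submodule.map (betaMap k P H Δ) N = ptensor k P H V := by
  refine le_antisymm hcompat ?_
  intro y hy
  -- the left `P`-linear map `id ⊗ ε : P ⊗ H → P`
  let e : (P ⊗[k] H) →ₗ[P] P :=
    (TensorProduct.AlgebraTensorModule.rid k P P).toLinearMap ∘ₗ
      TensorProduct.AlgebraTensorModule.map (LinearMap.id : P →ₗ[P] P)
        (Coalgebra.counit (R := k) (A := H))
  have heΔ : ∀ p : P, e (Δ p) = p := by
    intro p
    have h1 : e (Δ p) = TensorProduct.AlgebraTensorModule.rid k P P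
        ((TensorProduct.map (LinearMap.id : P →ₗ[k] P)
          (Coalgebra.counit (R := k) (A := H))) (Δ p)) := rfl
    rw [h1, hcu p]
    simp
  have heβ : ∀ x : P ⊗[k] P, e (betaMap k P H Δ x) = mulMap k P x := by
    intro x
    induction x using TensorProduct.induction_on with
    | zero => simp only [map_zero]
    | tmul a b => rw [betaMap_tmul, mulMap_tmul, map_smul, heΔ, smul_eq_mul]
    | add x y hx hy => simp only [map_add, hx, hy]
  have heV : ptensor k P H V ≤ LinearMap.ker e := by
    rw [ptensor, Submodule.span_le]
    rintro _ ⟨v, hv, rfl⟩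
    have hv0 : Coalgebra.counit (R := k) (A := H) v = 0 := hV hv
    simp [e, hv0]
  obtain ⟨q, hq⟩ := hcan y
  obtain ⟨x, rfl⟩ := Submodule.mkQ_surjective _ q
  have hx : betaMap k P H Δ x = y := hq
  have hxo : x ∈ omega1 k P := by
    change mulMap k P x = 0
    rw [← heβ, hx]
    exact heV hy
  have hmem : (N.comap (omega1 k P).subtype).mkQ ⟨x, hxo⟩ ∈
      LinearMap.ker (chiMap k P H Δ N V hcompat) := by
    change (ptensor k P H V).mkQ (betaMap k P H Δ x) = 0
    rw [hx]
    exact (Submodule.Quotient.mk_eq_zero _).2 hy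
  rw [hker] at hmem
  obtain ⟨w, hw, hwx⟩ := hmem
  have hn : w - ⟨x, hxo⟩ ∈ N.comap (omega1 k P).subtype :=
    (Submodule.Quotient.eq _).1 hwx
  have hn' : (w : P ⊗[k] P) - x ∈ N := hn
  have hw0 : betaMap k P H Δ (w : P ⊗[k] P) = 0 := POmega1BP_le_ker k P H Δ hw
  refine ⟨x - w, ?_, ?_⟩
  · have := N.neg_mem hn'
    rwa [neg_sub] at this
  · rw [map_sub, hw0, sub_zero, hx]

end
end

section
/- Suppose N_P is a P-subbimodule of Ω¹P and V is a vector subspace of H⁺ satisfying can̄(N_P) = P ⊗ V. If the sequence of left P-modules 0 → PΩ¹(B)P → Ω¹(P) → P ⊗ (H⁺/V) → 0 (with inclusion followed by χ) is exact and N_P ∩ Ker(can̄) ⊆ P(Ω¹B)P, then Ker(can̄) = P(Ω¹B)P. -/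
open TensorProduct

noncomputable section

variable (k : Type) [Field k] (P : Type) [Ring P] [Algebra k P]
variable (H : Type) [Ring H] [HopfAlgebra k H]

/-- with `N_P` a `P`-subbimodule of `Ω¹P` and `V ⊆ H⁺` satisfying
`can̄(N_P) = P ⊗ V`: if the sequence `0 → PΩ¹(B)P → Ω¹(P) → P ⊗ (H⁺/V) → 0` of left
`P`-modules is exact and `N_P ∩ Ker can̄ ⊆ P(Ω¹B)P`, then `Ker can̄ = P(Ω¹B)P`. -/
theorem ker_canbar_eq_of_quotient_sequence_exact
    (Δ : P →ₐ[k] P ⊗[k] H) (hco : IsCoassoc k P H Δ) (hcu : IsCounital k P H Δ)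
    (N : Submodule P (P ⊗[k] P)) (hN : N ≤ omega1 k P)
    (hNr : ∀ (p : P), ∀ x ∈ N,
      (TensorProduct.map LinearMap.id (LinearMap.mulRight k p)) x ∈ N)
    (V : Submodule k H) (hV : V ≤ hPlus k H)
    (hcompat : Submodule.map (betaMap k P H Δ) N = ptensor k P H V)
    (hker : LinearMap.ker (chiMap k P H Δ N V hcompat.le) =
          Submodule.map (N.comap (omega1 k P).subtype).mkQ
            ((POmega1BP k P H Δ).comap (omega1 k P).subtype))
    (hsurj : LinearMap.range (chiMap k P H Δ N V hcompat.le) =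
          Submodule.map (ptensor k P H V).mkQ (ptensor k P H (hPlus k H)))
    (hint : N ⊓ LinearMap.ker (betaMap k P H Δ) ≤ POmega1BP k P H Δ) :
    omega1 k P ⊓ LinearMap.ker (betaMap k P H Δ) = POmega1BP k P H Δ := by
  apply le_antisymm
  · rintro x ⟨hx, hx0⟩
    have hx0' : betaMap k P H Δ x = 0 := hx0
    have h1 : (N.comap (omega1 k P).subtype).mkQ ⟨x, hx⟩ ∈
        LinearMap.ker (chiMap k P H Δ N V hcompat.le) := by
      rw [LinearMap.mem_ker, chiMap, Submodule.mkQ_apply, Submodule.liftQ_apply]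
      simp [hx0']
    rw [hker] at h1
    obtain ⟨y, hy, hyx⟩ := Submodule.mem_map.mp h1
    have hy' : (y : P ⊗[k] P) ∈ POmega1BP k P H Δ := hy
    rw [Submodule.mkQ_apply, Submodule.mkQ_apply, Submodule.Quotient.eq] at hyx
    have h2 : (y : P ⊗[k] P) - x ∈ N := hyx
    have hy0 : betaMap k P H Δ (y : P ⊗[k] P) = 0 := POmega1BP_le_ker k P H Δ hy'
    have h3 : (y : P ⊗[k] P) - x ∈ POmega1BP k P H Δ :=
      hint ⟨h2, by
        change betaMap k P H Δ ((y : P ⊗[k] P) - x) = 0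
        rw [map_sub, hy0, hx0', sub_zero]⟩
    have h4 := Submodule.sub_mem _ hy' h3
    rwa [sub_sub_cancel] at h4
  · refine le_inf ?_ (POmega1BP_le_ker k P H Δ)
    rw [POmega1BP, Submodule.span_le]
    rintro x ⟨b, p', hb, rfl⟩
    change mulMap k P _ = 0
    rw [map_sub, mulMap_tmul, mulMap_tmul, one_mul, sub_self]

end
end

section
/- Suppose N_P is a P-subbimodule of Ω¹P and V is a vector subspace of H⁺ satisfying can̄(N_P) = P ⊗ V. If P is an H-Galois extension of B, then Ker(χ) = PΩ¹(B)P, i.e. the kernel of the induced map χ : Ω¹(P) → P ⊗ (H⁺/V) equals the image of P(Ω¹B)P in Ω¹(P). -/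
open TensorProduct

noncomputable section

variable (k : Type) [Field k] (P : Type) [Ring P] [Algebra k P]
variable (H : Type) [Ring H] [HopfAlgebra k H]

/-- with `N_P` a `P`-subbimodule of `Ω¹P` and `V ⊆ H⁺` satisfying
`can̄(N_P) = P ⊗ V`: if `P` is an `H`-Galois extension of `B`, then the kernel of the
induced map `χ : Ω¹(P) → P ⊗ (H⁺/V)` equals the image `PΩ¹(B)P` of `P(Ω¹B)P` in
`Ω¹(P)`. -/
theorem ker_chi_eq_of_galois
    (Δ : P →ₐ[k] P ⊗[k] H) (hco : IsCoassoc k P H Δ) (hcu : IsCounital k P H Δ)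
    (N : Submodule P (P ⊗[k] P)) (hN : N ≤ omega1 k P)
    (hNr : ∀ (p : P), ∀ x ∈ N,
      (TensorProduct.map LinearMap.id (LinearMap.mulRight k p)) x ∈ N)
    (V : Submodule k H) (hV : V ≤ hPlus k H)
    (hcompat : Submodule.map (betaMap k P H Δ) N = ptensor k P H V)
    (hgal : IsGaloisExtension k P H Δ) :
    LinearMap.ker (chiMap k P H Δ N V hcompat.le) =
          Submodule.map (N.comap (omega1 k P).subtype).mkQ
            ((POmega1BP k P H Δ).comap (omega1 k P).subtype) := by
  have hker : ∀ y, betaMap k P H Δ y = 0 → y ∈ POmega1BP k P H Δ := by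
    intro y hy
    rw [← Submodule.Quotient.mk_eq_zero]
    apply hgal.1
    rw [map_zero]
    exact hy
  apply le_antisymm
  · intro q hq
    obtain ⟨x, rfl⟩ := Submodule.mkQ_surjective _ q
    have hx : betaMap k P H Δ (x : P ⊗[k] P) ∈ ptensor k P H V := by
      rw [← Submodule.Quotient.mk_eq_zero]
      exact hq
    rw [← hcompat] at hx
    obtain ⟨n, hn, hnx⟩ := hx
    refine ⟨x - ⟨n, hN hn⟩, ?_, ?_⟩
    · apply hker
      rw [Submodule.subtype_apply, Submodule.coe_sub, map_sub, hnx, sub_self]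
    · rw [map_sub, sub_eq_self, Submodule.mkQ_apply, Submodule.Quotient.mk_eq_zero]
      exact hn
  · rintro q ⟨x, hx, rfl⟩
    have h0 : betaMap k P H Δ (x : P ⊗[k] P) = 0 := POmega1BP_le_ker k P H Δ hx
    change (ptensor k P H V).mkQ (betaMap k P H Δ (x : P ⊗[k] P)) = 0
    rw [h0, map_zero]

end
end
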